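/- arXiv:1109.0699 — 4 statements merged into one kernel-verified Lean document; each statement's English description precedes it below -/
import Mathlib

section
/- Let T be a set of L-sentences and let φ(x₁,…,xₙ), ψ(y₁,…,y_m) and σ(x₁,…,xₙ,y₁,…,y_m) be coherent L-formulas such that in every M ∈ M_T, σ defines the graph of a function from the set of n-tuples of M satisfying φ to the set of m-tuples of M satisfying ψ. Then the induced map D_φ → D_ψ over M_T, sending (M,m) to (M,k) for the unique k with σ(m,k) satisfied in M, is continuous with respect to the logical topologies. -/
open FirstOrder Language Set Topology TopologicalSpace Cardinal

universe u v w

namespace SemGpd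

variable (L : FirstOrder.Language.{u, v}) (S : Type w)

/-- An `S`-indexed `L`-structure: a subset `A ⊆ S`, an equivalence relation `≈` on `A`,
and an `L`-structure on the quotient `A/≈`. -/
structure IndexedStructure where
  A : Set S
  r : Setoid A
  str : L.Structure (Quotient r)

variable {L S}

/-- The underlying set (carrier) `A/≈` of an indexed structure. -/
abbrev IndexedStructure.carrier (M : IndexedStructure L S) : Type w := Quotient M.r

/-- The equivalence class of an indexed element. -/
def IndexedStructure.cls (M : IndexedStructure L S) (a : S) (h : a ∈ M.A) : M.carrier :=
  Quotient.mk M.r ⟨a, h⟩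

/-- Satisfaction of a formula in an indexed structure under an assignment. -/
def IndexedStructure.Sat (M : IndexedStructure L S) {α : Type*} (φ : L.Formula α)
    (v : α → M.carrier) : Prop :=
  letI := M.str
  φ.Realize v

/-- Satisfaction of a sentence in an indexed structure. -/
def IndexedStructure.SatSentence (M : IndexedStructure L S) (σ : L.Sentence) : Prop :=
  letI := M.str
  M.carrier ⊨ σ

/-- `M` is an `S`-indexed model of the theory `T`. -/
def IndexedStructure.models (M : IndexedStructure L S) (T : Set L.Sentence) : Prop :=
  ∀ σ ∈ T, M.SatSentence σ

variable (L S)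

/-- The basic set `⟨φ, a⟩` of indexed structures. -/
def fSet {n : ℕ} (φ : L.Formula (Fin n)) (a : Fin n → S) : Set (IndexedStructure L S) :=
  {M | ∃ h : ∀ i, a i ∈ M.A, M.Sat φ fun i => M.cls (a i) (h i)}

/-- The basic set `⟨a⟩` of structures in which `a` is indexed. -/
def membSet (a : S) : Set (IndexedStructure L S) :=
  {M | a ∈ M.A}

/-- The logical topology on the space of `S`-indexed `L`-structures, generated by the
membership conditions `⟨a⟩` and the atomic conditions `⟨φ, a⟩` for `φ` atomic (which include
the relation conditions `⟨R,a⟩`, the function conditions `⟨f(a)=b⟩` and equality conditions). -/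
def logicalTopology : TopologicalSpace (IndexedStructure L S) :=
  generateFrom {U | (∃ a : S, U = membSet L S a) ∨
    ∃ (n : ℕ) (φ : L.Formula (Fin n)), BoundedFormula.IsAtomic φ ∧
      ∃ a : Fin n → S, U = fSet L S φ a}

instance : TopologicalSpace (IndexedStructure L S) := logicalTopology L S

/-- An isomorphism between `S`-indexed `L`-structures. -/
structure IndexedIso where
  dom : IndexedStructure L S
  cod : IndexedStructure L S
  iso : @Language.Equiv L dom.carrier cod.carrier dom.str cod.str

variable {L S}

/-- Application of an isomorphism of indexed structures to an element of the domain. -/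
def IndexedIso.map (F : IndexedIso L S) (x : F.dom.carrier) : F.cod.carrier :=
  (@Language.Equiv.toEquiv L F.dom.carrier F.cod.carrier F.dom.str F.cod.str F.iso) x

/-- The basic set `⟨a ↦ b⟩` of isomorphisms. -/
def mapSet (a b : S) : Set (IndexedIso L S) :=
  {F | ∃ (ha : a ∈ F.dom.A) (hb : b ∈ F.cod.A),
    F.map (F.dom.cls a ha) = F.cod.cls b hb}

variable (L S)

/-- The logical topology on the space of isomorphisms of `S`-indexed `L`-structures:
the coarsest topology making `dom` and `cod` continuous and containing each `⟨a ↦ b⟩`. -/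
def isoTopology : TopologicalSpace (IndexedIso L S) :=
  ((logicalTopology L S).induced IndexedIso.dom) ⊓
    ((logicalTopology L S).induced IndexedIso.cod) ⊓
    generateFrom {V | ∃ a b : S, V = mapSet a b}

instance : TopologicalSpace (IndexedIso L S) := isoTopology L S

variable {L S}

/-- The identity isomorphism. -/
def idIso (M : IndexedStructure L S) : IndexedIso L S :=
  ⟨M, M, by letI := M.str; exact Language.Equiv.refl L M.carrier⟩

/-- The inverse of an isomorphism of indexed structures. -/
def IndexedIso.inv (F : IndexedIso L S) : IndexedIso L S :=
  ⟨F.cod, F.dom, by letI := F.dom.str; letI := F.cod.str; exact F.iso.symm⟩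

/-- The composite of two composable isomorphisms of indexed structures. -/
def IndexedIso.comp (F G : IndexedIso L S) (h : F.cod = G.dom) : IndexedIso L S :=
  ⟨F.dom, G.cod, by
    letI := F.dom.str; letI := F.cod.str; letI := G.cod.str
    exact Language.Equiv.comp (by rw [h]; exact G.iso) F.iso⟩

variable (L S)

/-- The space of composable pairs of isomorphisms, as a subspace of the product. -/
def CompPairs := {p : IndexedIso L S × IndexedIso L S // p.1.cod = p.2.dom}

instance : TopologicalSpace (CompPairs L S) :=
  instTopologicalSpaceSubtype

/-- The space `M_T` of `S`-indexed models of `T`, as a subspace of `M_L`. -/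
abbrev ModelsT (T : Set L.Sentence) := {M : IndexedStructure L S // M.models T}

/-- The space `I_T` of isomorphisms between `S`-indexed models of `T`, as a subspace of `I_L`. -/
abbrev IsoT (T : Set L.Sentence) := {F : IndexedIso L S // F.dom.models T ∧ F.cod.models T}

variable {L S}

/-- The domain map `d : I_T → M_T`. -/
def IsoT.d {T : Set L.Sentence} (F : IsoT L S T) : ModelsT L S T := ⟨F.1.dom, F.2.1⟩

/-- The codomain map `c : I_T → M_T`. -/
def IsoT.c {T : Set L.Sentence} (F : IsoT L S T) : ModelsT L S T := ⟨F.1.cod, F.2.2⟩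

/-- Horn formulas: finite conjunctions of atomic formulas (including `⊤`). -/
inductive IsHorn {α : Type*} : ∀ {n : ℕ}, L.BoundedFormula α n → Prop
  | top {n : ℕ} : IsHorn (⊤ : L.BoundedFormula α n)
  | equal {n : ℕ} (t₁ t₂ : L.Term (α ⊕ Fin n)) : IsHorn (t₁.bdEqual t₂)
  | rel {n k : ℕ} (R : L.Relations k) (ts : Fin k → L.Term (α ⊕ Fin n)) :
      IsHorn (R.boundedFormula ts)
  | inf {n : ℕ} {φ ψ : L.BoundedFormula α n} : IsHorn φ → IsHorn ψ → IsHorn (φ ⊓ ψ)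

/-- Coherent formulas: built from atomic formulas, `⊤` and `⊥` by `∧`, `∨` and `∃`. -/
inductive IsCoherent {α : Type*} : ∀ {n : ℕ}, L.BoundedFormula α n → Prop
  | falsum {n : ℕ} : IsCoherent (⊥ : L.BoundedFormula α n)
  | top {n : ℕ} : IsCoherent (⊤ : L.BoundedFormula α n)
  | equal {n : ℕ} (t₁ t₂ : L.Term (α ⊕ Fin n)) : IsCoherent (t₁.bdEqual t₂)
  | rel {n k : ℕ} (R : L.Relations k) (ts : Fin k → L.Term (α ⊕ Fin n)) :
      IsCoherent (R.boundedFormula ts)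
  | inf {n : ℕ} {φ ψ : L.BoundedFormula α n} : IsCoherent φ → IsCoherent ψ → IsCoherent (φ ⊓ ψ)
  | sup {n : ℕ} {φ ψ : L.BoundedFormula α n} : IsCoherent φ → IsCoherent ψ → IsCoherent (φ ⊔ ψ)
  | ex {n : ℕ} {φ : L.BoundedFormula α (n + 1)} : IsCoherent φ → IsCoherent φ.ex

/-- A coherent sequent: a sentence of the form `∀ x₁ … xₙ (φ → ψ)` with `φ, ψ` coherent. -/
def IsCoherentSequent (σ : L.Sentence) : Prop :=
  ∃ (n : ℕ) (φ ψ : L.BoundedFormula Empty n),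
    IsCoherent φ ∧ IsCoherent ψ ∧ σ = (φ.imp ψ).alls


variable (L S)

/-- The sheaf `D_φ` of realizations of `φ` over the space of `S`-indexed models of `T`. -/
structure DSet (T : Set L.Sentence) {n : ℕ} (φ : L.Formula (Fin n)) where
  str : IndexedStructure L S
  mods : str.models T
  tup : Fin n → str.carrier
  sat : str.Sat φ tup

variable {L S}

/-- The projection `π₁ : D_φ → M_T`. -/
def DSet.pi {T : Set L.Sentence} {n : ℕ} {φ : L.Formula (Fin n)} (d : DSet L S T φ) :
    ModelsT L S T := ⟨d.str, d.mods⟩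

variable (L S)

/-- The image of the section `s_a : ⟨φ,a⟩ ∩ M_T → D_φ`. -/
def secImage (T : Set L.Sentence) {n : ℕ} (φ : L.Formula (Fin n)) (a : Fin n → S) :
    Set (DSet L S T φ) :=
  {d | ∃ h : ∀ i, a i ∈ d.str.A, d.tup = fun i => d.str.cls (a i) (h i)}

/-- The logical topology on `D_φ`: the coarsest topology making `π₁` continuous and making the
image of every section `s_a` open. -/
def dTopology (T : Set L.Sentence) {n : ℕ} (φ : L.Formula (Fin n)) :
    TopologicalSpace (DSet L S T φ) :=
  (TopologicalSpace.induced DSet.pi inferInstance) ⊓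
    generateFrom {V | ∃ a : Fin n → S, V = secImage L S T φ a}

instance {T : Set L.Sentence} {n : ℕ} {φ : L.Formula (Fin n)} :
    TopologicalSpace (DSet L S T φ) := dTopology L S T φ

/-- The basic open set `⟨ψ, b⟩` of `D_φ`. -/
def dBasic (T : Set L.Sentence) {n : ℕ} (φ : L.Formula (Fin n)) {m : ℕ}
    (ψ : L.Formula (Fin n ⊕ Fin m)) (b : Fin m → S) : Set (DSet L S T φ) :=
  {d | ∃ h : ∀ j, b j ∈ d.str.A,
    d.str.Sat ψ (Sum.elim d.tup fun j => d.str.cls (b j) (h j))}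

/-- The fiber product `I_T ×_{M_T} D_φ` of composable pairs for the application action. -/
def ActPairs (T : Set L.Sentence) {n : ℕ} (φ : L.Formula (Fin n)) :=
  {p : IsoT L S T × DSet L S T φ // p.1.1.dom = p.2.str}

instance {T : Set L.Sentence} {n : ℕ} {φ : L.Formula (Fin n)} :
    TopologicalSpace (ActPairs L S T φ) := instTopologicalSpaceSubtype

variable {L S}

/-- Isomorphisms of indexed structures preserve satisfaction. -/
theorem IndexedIso.sat_map (F : IndexedIso L S) {α : Type*} (φ : L.Formula α)
    (v : α → F.dom.carrier) (h : F.dom.Sat φ v) :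
    F.cod.Sat φ fun i => F.map (v i) := by
  letI := F.dom.str
  letI := F.cod.str
  have := (StrongHomClass.realize_formula (F.iso) φ (v := v)).mpr h
  exact this

/-- Transport of satisfaction along an equality of indexed structures. -/
theorem sat_cast {M N : IndexedStructure L S} (h : M = N) {α : Type*} (φ : L.Formula α)
    (v : α → N.carrier) (hs : N.Sat φ v) :
    M.Sat φ fun i => cast (congrArg IndexedStructure.carrier h.symm) (v i) := by
  subst h; exact hs

/-- The application action `θ : I_T ×_{M_T} D_φ → D_φ`. -/
def act {T : Set L.Sentence} {n : ℕ} {φ : L.Formula (Fin n)} (p : ActPairs L S T φ) :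
    DSet L S T φ where
  str := p.1.1.1.cod
  mods := p.1.1.2.2
  tup := fun i =>
    p.1.1.1.map (cast (congrArg IndexedStructure.carrier p.2.symm) (p.1.2.tup i))
  sat := p.1.1.1.sat_map φ _ (sat_cast p.2 φ p.1.2.tup p.1.2.sat)

/-- A subset of `D_φ` is stable if it is closed under the application action. -/
def Stable {T : Set L.Sentence} {n : ℕ} {φ : L.Formula (Fin n)}
    (X : Set (DSet L S T φ)) : Prop :=
  ∀ p : ActPairs L S T φ, p.1.2 ∈ X → act p ∈ X

/-- The stabilization of a subset of `D_φ`: the smallest stable subset containing it. -/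
def stabilization {T : Set L.Sentence} {n : ℕ} {φ : L.Formula (Fin n)}
    (X : Set (DSet L S T φ)) : Set (DSet L S T φ) :=
  ⋂₀ {Y | X ⊆ Y ∧ Stable Y}

/-- The set `{(M,m) ∈ D_φ : M ⊨ ∃y ψ(m,y)}`. -/
def exSet {T : Set L.Sentence} {n : ℕ} (φ : L.Formula (Fin n)) {m : ℕ}
    (ψ : L.Formula (Fin n ⊕ Fin m)) : Set (DSet L S T φ) :=
  {d | ∃ w : Fin m → d.str.carrier, d.str.Sat ψ (Sum.elim d.tup w)}

/-- The identity isomorphism on a model of `T`, as an element of `I_T`. -/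
def idIsoT {T : Set L.Sentence} (M : ModelsT L S T) : IsoT L S T :=
  ⟨idIso M.1, M.2, M.2⟩

/-- The inverse, in `I_T`. -/
def IsoT.inv {T : Set L.Sentence} (F : IsoT L S T) : IsoT L S T :=
  ⟨F.1.inv, F.2.2, F.2.1⟩

/-- The composite, in `I_T`. -/
def IsoT.comp {T : Set L.Sentence} (F G : IsoT L S T) (h : F.1.cod = G.1.dom) : IsoT L S T :=
  ⟨F.1.comp G.1 h, F.2.1, G.2.2⟩



variable {L : FirstOrder.Language.{u, v}} {S : Type w}

/-- The indexed structures in which the parameters `a` and `b` are indexed and `φ` holds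
at their equivalence classes. -/
def realizeSet {α : Type*} {k : ℕ} (φ : L.BoundedFormula α k) (a : α → S) (b : Fin k → S) :
    Set (IndexedStructure L S) :=
  {M | ∃ (ha : ∀ i, a i ∈ M.A) (hb : ∀ j, b j ∈ M.A),
    letI := M.str
    φ.Realize (fun i => M.cls (a i) (ha i)) (fun j => M.cls (b j) (hb j))}

theorem isOpen_membSet (a : S) : IsOpen (membSet L S a) :=
  isOpen_generateFrom_of_mem (Or.inl ⟨a, rfl⟩)

theorem isOpen_fSet {n : ℕ} {φ : L.Formula (Fin n)} (hφ : BoundedFormula.IsAtomic φ)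
    (a : Fin n → S) : IsOpen (fSet L S φ a) :=
  isOpen_generateFrom_of_mem (Or.inr ⟨n, φ, hφ, a, rfl⟩)

theorem isOpen_indexed {ι : Type*} [Finite ι] (a : ι → S) :
    IsOpen {M : IndexedStructure L S | ∀ i, a i ∈ M.A} := by
  have h : {M : IndexedStructure L S | ∀ i, a i ∈ M.A} = ⋂ i, membSet L S (a i) := by
    ext M
    simp [membSet]
  rw [h]
  exact isOpen_iInter_of_finite fun i => isOpen_membSet (a i)

/-- The extent of `φ` is open if `φ` becomes equivalent to an atomic formula after its variables
are enumerated by `e`. -/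
theorem isOpen_realizeSet_of_atomic {α : Type*} {k N : ℕ} (e : α ⊕ Fin k ≃ Fin N)
    (φ : L.BoundedFormula α k) {χ : L.Formula (Fin N)} (hχ : BoundedFormula.IsAtomic χ)
    (hiff : ∀ (M : IndexedStructure L S) (v : α → M.carrier) (w : Fin k → M.carrier),
      M.Sat χ (Sum.elim v w ∘ e.symm) ↔ (letI := M.str; φ.Realize v w))
    (a : α → S) (b : Fin k → S) : IsOpen (realizeSet φ a b) := by
  have h : realizeSet φ a b = fSet L S χ (Sum.elim a b ∘ e.symm) := by
    have hcls : ∀ (M : IndexedStructure L S) (ha : ∀ i, a i ∈ M.A) (hb : ∀ j, b j ∈ M.A)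
        (hc : ∀ l, (Sum.elim a b ∘ e.symm) l ∈ M.A),
        (fun l => M.cls ((Sum.elim a b ∘ e.symm) l) (hc l)) =
          Sum.elim (fun i => M.cls (a i) (ha i)) (fun j => M.cls (b j) (hb j)) ∘ e.symm := by
      intro M ha hb hc
      funext l
      obtain ⟨x, rfl⟩ := e.surjective l
      cases x <;> simp
    ext M
    constructor
    · rintro ⟨ha, hb, hM⟩
      have hc : ∀ l, (Sum.elim a b ∘ e.symm) l ∈ M.A := by
        intro l
        obtain ⟨x, rfl⟩ := e.surjective l
        cases x <;> simp [ha, hb]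
      refine ⟨hc, ?_⟩
      rw [hcls M ha hb hc]
      exact (hiff M _ _).2 hM
    · rintro ⟨hc, hM⟩
      have ha : ∀ i, a i ∈ M.A := fun i => by simpa using hc (e (Sum.inl i))
      have hb : ∀ j, b j ∈ M.A := fun j => by simpa using hc (e (Sum.inr j))
      rw [hcls M ha hb hc] at hM
      exact ⟨ha, hb, (hiff M _ _).1 hM⟩
  rw [h]
  exact isOpen_fSet hχ _

/-- Coherent formulas have open extents in the logical topology. -/
theorem IsCoherent.isOpen_realizeSet {α : Type*} [Finite α] {k : ℕ} {φ : L.BoundedFormula α k}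
    (hφ : IsCoherent φ) (a : α → S) (b : Fin k → S) : IsOpen (realizeSet φ a b) := by
  induction hφ with
  | falsum =>
    convert isOpen_empty
    ext M
    simp [realizeSet]
  | top =>
    convert (isOpen_indexed (L := L) a).inter (isOpen_indexed b)
    ext M
    simp [realizeSet]
  | @equal k t₁ t₂ =>
    obtain ⟨N, ⟨e⟩⟩ := Finite.exists_equiv_fin (α ⊕ Fin k)
    refine isOpen_realizeSet_of_atomic e _
      (BoundedFormula.IsAtomic.equal (t₁.relabel (Sum.inl ∘ e)) (t₂.relabel (Sum.inl ∘ e)))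
      (fun M v w => ?_) a b
    let := M.str
    simp [IndexedStructure.Sat, Formula.Realize, Term.realize_relabel, ← Function.comp_assoc,
      Function.comp_assoc _ e.symm e]
  | @rel k _ R ts =>
    obtain ⟨N, ⟨e⟩⟩ := Finite.exists_equiv_fin (α ⊕ Fin k)
    refine isOpen_realizeSet_of_atomic e _
      (BoundedFormula.IsAtomic.rel R fun i => (ts i).relabel (Sum.inl ∘ e))
      (fun M v w => ?_) a b
    let := M.str
    simp [IndexedStructure.Sat, Formula.Realize, Term.realize_relabel, ← Function.comp_assoc,
      Function.comp_assoc _ e.symm e]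
  | inf _ _ ih₁ ih₂ =>
    convert (ih₁ b).inter (ih₂ b)
    ext M
    simp only [realizeSet, BoundedFormula.realize_inf, mem_inter_iff, mem_ofPred_eq]
    grind
  | sup _ _ ih₁ ih₂ =>
    convert (ih₁ b).union (ih₂ b)
    ext M
    simp only [realizeSet, BoundedFormula.realize_sup, mem_union, mem_ofPred_eq]
    grind
  | @ex k φ _ ih =>
    have h : realizeSet φ.ex a b = ⋃ s : S, realizeSet φ a (Fin.snoc b s : Fin (k + 1) → S) := by
      have hcls : ∀ (M : IndexedStructure L S) (s : S) (hb : ∀ j, b j ∈ M.A) (hs : s ∈ M.A)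
          (hc : ∀ j, (Fin.snoc b s : Fin (k + 1) → S) j ∈ M.A),
          (fun j => M.cls ((Fin.snoc b s : Fin (k + 1) → S) j) (hc j)) =
            Fin.snoc (fun j => M.cls (b j) (hb j)) (M.cls s hs) := by
        intro M s hb hs hc
        funext j
        induction j using Fin.lastCases <;> simp
      ext M
      simp only [realizeSet, BoundedFormula.realize_ex, mem_iUnion, mem_ofPred_eq]
      constructor
      · rintro ⟨ha, hb, x, hx⟩
        obtain ⟨⟨s, hs⟩, rfl⟩ := Quotient.exists_rep x
        have hc : ∀ j, (Fin.snoc b s : Fin (k + 1) → S) j ∈ M.A := by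
          intro j
          induction j using Fin.lastCases <;> simp [hb, hs]
        refine ⟨s, ha, hc, ?_⟩
        rw [hcls M s hb hs hc]
        exact hx
      · rintro ⟨s, ha, hc, hM⟩
        have hb : ∀ j, b j ∈ M.A := fun j => by simpa using hc j.castSucc
        have hs : s ∈ M.A := by simpa using hc (Fin.last k)
        rw [hcls M s hb hs hc] at hM
        exact ⟨ha, hb, _, hM⟩
    rw [h]
    exact isOpen_iUnion fun s => ih _

theorem realize_iff_sat (M : IndexedStructure L S) {α : Type*} (φ : L.Formula α)
    (v : α → M.carrier) {w : Fin 0 → M.carrier} :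
    (letI := M.str; BoundedFormula.Realize φ v w) ↔ M.Sat φ v := by
  rw [Subsingleton.elim w default]
  rfl

theorem DSet.continuous_pi {T : Set L.Sentence} {n : ℕ} {φ : L.Formula (Fin n)} :
    Continuous (DSet.pi : DSet L S T φ → ModelsT L S T) :=
  continuous_iff_le_induced.2 inf_le_left

theorem isOpen_secImage (T : Set L.Sentence) {n : ℕ} (φ : L.Formula (Fin n)) (a : Fin n → S) :
    IsOpen (secImage L S T φ a) :=
  (inf_le_right : dTopology L S T φ ≤ _) _ (isOpen_generateFrom_of_mem ⟨a, rfl⟩)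

theorem DSet.mem_secImage_exists {T : Set L.Sentence} {n : ℕ} {φ : L.Formula (Fin n)}
    (d : DSet L S T φ) : ∃ a, d ∈ secImage L S T φ a := by
  choose r hr using fun i => Quotient.exists_rep (d.tup i)
  exact ⟨fun i => r i, fun i => (r i).2, funext fun i => (hr i).symm⟩

/-- The sets `⟨ψ, b⟩` with `ψ` coherent are open in `D_φ`. -/
theorem IsCoherent.isOpen_dBasic (T : Set L.Sentence) {n m : ℕ} (φ : L.Formula (Fin n))
    {ψ : L.Formula (Fin n ⊕ Fin m)} (hψ : IsCoherent ψ) (b : Fin m → S) :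
    IsOpen (dBasic L S T φ ψ b) := by
  have h : dBasic L S T φ ψ b = ⋃ a : Fin n → S, secImage L S T φ a ∩
      (fun d => (DSet.pi d).1) ⁻¹' realizeSet ψ (Sum.elim a b) Fin.elim0 := by
    have hcls : ∀ (M : IndexedStructure L S) (a : Fin n → S) (ha : ∀ i, a i ∈ M.A)
        (hb : ∀ j, b j ∈ M.A) (hc : ∀ x, Sum.elim a b x ∈ M.A),
        (fun x => M.cls (Sum.elim a b x) (hc x)) =
          Sum.elim (fun i => M.cls (a i) (ha i)) (fun j => M.cls (b j) (hb j)) := by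
      intro M a ha hb hc
      funext x
      cases x <;> rfl
    ext d
    simp only [mem_iUnion, mem_inter_iff, mem_preimage]
    constructor
    · rintro ⟨hb, hd⟩
      obtain ⟨a, ha, hda⟩ := d.mem_secImage_exists
      have hc : ∀ x, Sum.elim a b x ∈ d.str.A := by simp [ha, hb]
      refine ⟨a, ⟨ha, hda⟩, hc, fun j => j.elim0, ?_⟩
      rw [hda, ← hcls d.str a ha hb hc] at hd
      exact (realize_iff_sat _ _ _).2 hd
    · rintro ⟨a, ⟨ha, hda⟩, hc, _, hd⟩
      have hb : ∀ j, b j ∈ d.str.A := fun j => hc (Sum.inr j)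
      refine ⟨hb, ?_⟩
      rw [hda, ← hcls d.str a ha hb hc]
      exact (realize_iff_sat _ _ _).1 hd
  rw [h]
  exact isOpen_iUnion fun a => (isOpen_secImage T φ a).inter
    ((hψ.isOpen_realizeSet _ _).preimage (continuous_subtype_val.comp DSet.continuous_pi))

theorem stmt12 (T : Set L.Sentence) {n m : ℕ} (φ : L.Formula (Fin n))
    (ψ : L.Formula (Fin m)) (σ : L.Formula (Fin n ⊕ Fin m))
    (hφ : IsCoherent φ) (hψ : IsCoherent ψ) (hσ : IsCoherent σ)
    (hgraph : ∀ M : IndexedStructure L S, M.models T →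
      (∀ (v : Fin n → M.carrier) (w : Fin m → M.carrier),
        M.Sat σ (Sum.elim v w) → M.Sat φ v ∧ M.Sat ψ w) ∧
      (∀ v : Fin n → M.carrier, M.Sat φ v →
        ∃! w : Fin m → M.carrier, M.Sat σ (Sum.elim v w))) :
    ∃ F : DSet L S T φ → DSet L S T ψ,
      (∀ d : DSet L S T φ, ∃ h : (F d).str = d.str,
        d.str.Sat σ (Sum.elim d.tup
          fun j => cast (congrArg IndexedStructure.carrier h) ((F d).tup j))) ∧
      Continuous F := by
  choose f hf huniq using fun d : DSet L S T φ => (hgraph d.str d.mods).2 d.tup d.sat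
  let F : DSet L S T φ → DSet L S T ψ := fun d =>
    ⟨d.str, d.mods, f d, ((hgraph d.str d.mods).1 _ _ (hf d)).2⟩
  refine ⟨F, fun d => ⟨rfl, hf d⟩, ?_⟩
  have hpi : Continuous (DSet.pi ∘ F) := DSet.continuous_pi (φ := φ)
  refine continuous_inf_rng.2 ⟨continuous_induced_rng.2 hpi, continuous_generateFrom_iff.2 ?_⟩
  rintro _ ⟨b, rfl⟩
  convert hσ.isOpen_dBasic T φ b
  ext d
  constructor
  · rintro ⟨hb, hd⟩
    refine ⟨hb, ?_⟩
    have hfd : f d = fun j => d.str.cls (b j) (hb j) := hd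
    rw [← hfd]
    exact hf d
  · rintro ⟨hb, hd⟩
    exact ⟨hb, (huniq d _ hd).symm⟩

end SemGpd
end

section
/- Let T be a set of L-sentences and φ an L-formula with free variables among x₁,…,xₙ. The application action θ : I_T ×_{M_T} D_φ → D_φ, sending a pair ((M,N,f),(M,m)) to (N, f(m)) with f applied componentwise to the tuple m, is well defined (isomorphisms preserve satisfaction of φ) and continuous, where the fiber product over d and π₁ carries the subspace topology of the product; moreover θ satisfies the action laws θ(id_M, x) = x and θ(g∘f, x) = θ(g, θ(f, x)). -/
open FirstOrder Language Set Topology TopologicalSpace Cardinal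

universe u v w

namespace SemGpd

variable (L : FirstOrder.Language.{u, v}) (S : Type w)

variable {L S}

variable (L S)

variable {L S}

variable (L S)

variable {L S}

variable (L S)

variable {L S}

variable (L S)

variable {L S}

variable (L S)

variable {L S}

variable {L : FirstOrder.Language.{u, v}} {S : Type w}

theorem isOpen_mapSet (a b : S) : IsOpen (mapSet a b : Set (IndexedIso L S)) := by
  have hle : isoTopology L S ≤ generateFrom {V | ∃ a b : S, V = mapSet a b} := inf_le_right
  exact hle _ (isOpen_generateFrom_of_mem ⟨a, b, rfl⟩)

theorem continuous_cod : Continuous (IndexedIso.cod : IndexedIso L S → IndexedStructure L S) := by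
  rw [continuous_iff_le_induced]
  exact inf_le_left.trans inf_le_right

theorem continuous_actPairs_fst {T : Set L.Sentence} {n : ℕ} {φ : L.Formula (Fin n)} :
    Continuous fun p : ActPairs L S T φ => p.1.1 :=
  continuous_fst.comp continuous_subtype_val

theorem continuous_actPairs_snd {T : Set L.Sentence} {n : ℕ} {φ : L.Formula (Fin n)} :
    Continuous fun p : ActPairs L S T φ => p.1.2 :=
  continuous_snd.comp continuous_subtype_val

/-- The image of `(F, d)` lies in the section at `b` exactly when `d` lies in the section at some
`a` that `F` maps to `b` componentwise. -/
theorem act_mem_secImage_iff {T : Set L.Sentence} {n : ℕ} {φ : L.Formula (Fin n)}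
    (p : ActPairs L S T φ) (b : Fin n → S) :
    act p ∈ secImage L S T φ b ↔
      ∃ a : Fin n → S, p.1.2 ∈ secImage L S T φ a ∧ ∀ i, p.1.1.1 ∈ mapSet (a i) (b i) := by
  obtain ⟨⟨⟨⟨M, N, f⟩, hM, hN⟩, ⟨M', hM', m, hm⟩⟩, h⟩ := p
  dsimp only at h
  subst h
  constructor
  · rintro ⟨hb, h⟩
    choose a ha using fun i => Quotient.exists_rep (m i)
    refine ⟨fun i => (a i).1, ⟨fun i => (a i).2, funext fun i => (ha i).symm⟩,
      fun i => ⟨(a i).2, hb i, ?_⟩⟩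
    refine Eq.trans ?_ (congrFun h i)
    exact congrArg _ (ha i)
  · rintro ⟨a, ⟨ha, h⟩, hab⟩
    refine ⟨fun i => (hab i).2.1, funext fun i => ?_⟩
    refine Eq.trans ?_ (hab i).2.2
    exact congrArg _ (congrFun h i)

theorem continuous_act (T : Set L.Sentence) {n : ℕ} (φ : L.Formula (Fin n)) :
    Continuous (act : ActPairs L S T φ → DSet L S T φ) := by
  refine continuous_inf_rng.2 ⟨continuous_induced_rng.2 ?_, continuous_generateFrom_iff.2 ?_⟩
  · exact (continuous_cod.comp (continuous_subtype_val.comp continuous_actPairs_fst)).subtype_mk _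
  · rintro _ ⟨b, rfl⟩
    have hpre : act ⁻¹' secImage L S T φ b =
        ⋃ a : Fin n → S, ((fun p : ActPairs L S T φ => p.1.2) ⁻¹' secImage L S T φ a) ∩
          ⋂ i, (fun p : ActPairs L S T φ => p.1.1.1) ⁻¹' mapSet (a i) (b i) := by
      ext p
      simp [act_mem_secImage_iff]
    rw [hpre]
    exact isOpen_iUnion fun a =>
      ((isOpen_secImage T φ a).preimage continuous_actPairs_snd).inter <|
        isOpen_iInter_of_finite fun i => (isOpen_mapSet (a i) (b i)).preimage <|
          continuous_subtype_val.comp continuous_actPairs_fst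

theorem act_idIsoT {T : Set L.Sentence} {n : ℕ} {φ : L.Formula (Fin n)} (d : DSet L S T φ)
    (h : (idIsoT d.pi).1.dom = d.str) : act ⟨(idIsoT d.pi, d), h⟩ = d := rfl

theorem act_comp {T : Set L.Sentence} {n : ℕ} {φ : L.Formula (Fin n)} (F G : IsoT L S T)
    (d : DSet L S T φ) (h1 : F.1.cod = G.1.dom) (h2 : (F.comp G h1).1.dom = d.str)
    (h3 : F.1.dom = d.str) (h4 : G.1.dom = (act ⟨(F, d), h3⟩).str) :
    act ⟨(F.comp G h1, d), h2⟩ = act ⟨(G, act ⟨(F, d), h3⟩), h4⟩ := by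
  obtain ⟨⟨M, N, f⟩, hM, hN⟩ := F
  obtain ⟨⟨N', K, g⟩, hN', hK⟩ := G
  obtain ⟨M', hM', m, hm⟩ := d
  dsimp only at h1 h3
  subst h1 h3
  rfl

theorem stmt13 (T : Set L.Sentence) {n : ℕ} (φ : L.Formula (Fin n)) :
    (∀ (F : IndexedIso L S) (v : Fin n → F.dom.carrier),
      F.dom.Sat φ v → F.cod.Sat φ fun i => F.map (v i)) ∧
    Continuous (act : ActPairs L S T φ → DSet L S T φ) ∧
    (∀ (d : DSet L S T φ) (h : (idIsoT d.pi).1.dom = d.str),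
      act ⟨(idIsoT d.pi, d), h⟩ = d) ∧
    (∀ (F G : IsoT L S T) (d : DSet L S T φ) (h1 : F.1.cod = G.1.dom)
      (h2 : (F.comp G h1).1.dom = d.str) (h3 : F.1.dom = d.str)
      (h4 : G.1.dom = (act ⟨(F, d), h3⟩).str),
      act ⟨(F.comp G h1, d), h2⟩ = act ⟨(G, act ⟨(F, d), h3⟩), h4⟩) := by
  exact ⟨fun F v => F.sat_map φ v, continuous_act T φ, act_idIsoT, act_comp⟩

end SemGpd
end

section
/- Assume S is infinite. Let T be a set of L-sentences, φ an L-formula with free variables among x₁,…,xₙ, ψ an L-formula with free variables among x₁,…,xₙ,y₁,…,y_m, and a an m-tuple of pairwise distinct elements of S. Then the stabilization (closure under the action θ) of the set ⟨ψ,a⟩_{D_φ} := {(M,m) ∈ D_φ : every aⱼ is indexed in M and ψ is satisfied in M under xᵢ ↦ mᵢ, yⱼ ↦ [aⱼ]} equals {(M,m) ∈ D_φ : ∃y₁…∃y_m ψ is satisfied in M under xᵢ ↦ mᵢ}. -/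
open FirstOrder Language Set Topology TopologicalSpace Cardinal

universe u v w

namespace SemGpd

variable (L : FirstOrder.Language.{u, v}) (S : Type w)

variable {L S}

variable (L S)

variable {L S}

variable (L S)

variable {L S}

variable (L S)

variable {L S}

variable (L S)

variable {L S}

variable (L S)

variable {L S}

variable {L : FirstOrder.Language.{u, v}} {S : Type w}

/-- The indexed structure obtained by transporting `M` along a surjection onto its carrier. -/
noncomputable def IndexedStructure.transport (M : IndexedStructure L S) {B : Set S}
    (g : B → M.carrier) (hg : Function.Surjective g) : IndexedStructure L S where
  A := B
  r := Setoid.ker g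
  str :=
    letI := M.str
    (Setoid.quotientKerEquivOfSurjective g hg).symm.inducedStructure

/-- The canonical isomorphism from a transported structure to the original one. -/
noncomputable def IndexedStructure.transportIso (M : IndexedStructure L S) {B : Set S}
    (g : B → M.carrier) (hg : Function.Surjective g) : IndexedIso L S where
  dom := M.transport g hg
  cod := M
  iso :=
    letI := M.str
    letI : L.Structure (Quotient (Setoid.ker g)) := (M.transport g hg).str
    (Setoid.quotientKerEquivOfSurjective g hg).symm.inducedStructureEquiv.symm

theorem IndexedStructure.transportIso_map_cls (M : IndexedStructure L S) {B : Set S}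
    (g : B → M.carrier) (hg : Function.Surjective g) (b : S) (hb : b ∈ B) :
    (M.transportIso g hg).map ((M.transport g hg).cls b hb) = g ⟨b, hb⟩ :=
  rfl

theorem IndexedStructure.Sat.congr {M : IndexedStructure L S} {α : Type*} {φ : L.Formula α}
    {v v' : α → M.carrier} (h : M.Sat φ v) (hv : v = v') : M.Sat φ v' :=
  hv ▸ h

theorem IndexedIso.models_inv (F : IndexedIso L S) {T : Set L.Sentence}
    (h : F.cod.models T) : F.dom.models T := by
  intro σ hσ
  let := F.dom.str
  let := F.cod.str
  exact (StrongHomClass.realize_sentence F.iso σ).mpr (h σ hσ)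

theorem IndexedIso.map_inv_map (F : IndexedIso L S) (x : F.cod.carrier) :
    F.map (F.inv.map x) = x :=
  let := F.dom.str
  let := F.cod.str
  F.iso.apply_symm_apply x

theorem IndexedIso.inv_map_map (F : IndexedIso L S) (x : F.dom.carrier) :
    F.inv.map (F.map x) = x :=
  let := F.dom.str
  let := F.cod.str
  F.iso.symm_apply_apply x

/-- An infinite set `S` has enough elements to index any quotient of a subset of `S` with
finitely many prescribed indices. -/
theorem IndexedStructure.exists_indexing [Infinite S] (M : IndexedStructure L S) {m : ℕ}
    {a : Fin m → S} (ha : Function.Injective a) (w : Fin m → M.carrier) :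
    ∃ (B : Set S) (g : B → M.carrier), Function.Surjective g ∧
      ∀ j, ∃ h : a j ∈ B, g ⟨a j, h⟩ = w j := by
  have hcard : #M.carrier ≤ #((range a)ᶜ : Set S) := by
    rw [mk_compl_of_infinite _ ((Cardinal.lt_aleph0_of_finite _).trans_le (aleph0_le_mk S))]
    exact (mk_quotient_le).trans (mk_set_le _)
  obtain ⟨ι⟩ := hcard
  have key : ∀ b : (range a ∪ range fun k => (ι k : S) : Set S), ∃ k : M.carrier,
      (∃ j, a j = b ∧ w j = k) ∨ (ι k : S) = b := by
    rintro ⟨b, ⟨j, rfl⟩ | ⟨k, rfl⟩⟩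
    · exact ⟨w j, .inl ⟨j, rfl, rfl⟩⟩
    · exact ⟨k, .inr rfl⟩
  choose g hg using key
  refine ⟨_, g, fun k => ⟨⟨ι k, .inr ⟨k, rfl⟩⟩, ?_⟩, fun j => ⟨.inl ⟨j, rfl⟩, ?_⟩⟩
  · rcases hg ⟨ι k, .inr ⟨k, rfl⟩⟩ with ⟨j, hj, -⟩ | h
    · exact absurd ⟨j, hj⟩ (ι k).2
    · exact ι.injective (Subtype.ext h)
  · rcases hg ⟨a j, .inl ⟨j, rfl⟩⟩ with ⟨i, hi, h⟩ | h
    · rw [← h, ha hi]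
    · exact absurd ⟨j, h.symm⟩ (ι _).2

theorem subset_stabilization {T : Set L.Sentence} {n : ℕ} {φ : L.Formula (Fin n)}
    (X : Set (DSet L S T φ)) : X ⊆ stabilization X :=
  fun _ hd _ hY => hY.1 hd

theorem stable_stabilization {T : Set L.Sentence} {n : ℕ} {φ : L.Formula (Fin n)}
    (X : Set (DSet L S T φ)) : Stable (stabilization X) :=
  fun p hp Y hY => hY.2 p (hp Y hY)

theorem stable_exSet (T : Set L.Sentence) {n m : ℕ} (φ : L.Formula (Fin n))
    (ψ : L.Formula (Fin n ⊕ Fin m)) : Stable (exSet (S := S) (T := T) φ ψ) := by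
  rintro ⟨⟨⟨F, hF⟩, d⟩, hp⟩ ⟨w, hw⟩
  obtain ⟨M, mods, tup, sat⟩ := d
  dsimp only at hp
  subst hp
  refine ⟨fun j => F.map (w j), (F.sat_map ψ _ hw).congr (funext fun x => ?_)⟩
  rcases x with i | j <;> rfl

theorem dBasic_subset_exSet (T : Set L.Sentence) {n m : ℕ} (φ : L.Formula (Fin n))
    (ψ : L.Formula (Fin n ⊕ Fin m)) (a : Fin m → S) : dBasic L S T φ ψ a ⊆ exSet φ ψ :=
  fun _ ⟨_, h⟩ => ⟨_, h⟩

theorem stmt14 [Infinite S] (T : Set L.Sentence) {n m : ℕ} (φ : L.Formula (Fin n))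
    (ψ : L.Formula (Fin n ⊕ Fin m)) (a : Fin m → S) (ha : Function.Injective a) :
    stabilization (dBasic L S T φ ψ a) = exSet φ ψ := by
  refine Subset.antisymm
    (sInter_subset_of_mem ⟨dBasic_subset_exSet T φ ψ a, stable_exSet T φ ψ⟩) ?_
  rintro ⟨M, mods, tup, sat⟩ ⟨w, hw⟩
  obtain ⟨B, g, hg, hgw⟩ := M.exists_indexing ha w
  choose hB hgw using hgw
  let F := M.transportIso g hg
  have hF : F.dom.models T := F.models_inv mods
  let d : DSet L S T φ := ⟨F.dom, hF, fun i => F.inv.map (tup i), F.inv.sat_map φ tup sat⟩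
  have hd : d ∈ dBasic L S T φ ψ a := by
    refine ⟨hB, (F.inv.sat_map ψ _ hw).congr (funext fun x => ?_)⟩
    rcases x with i | j
    · rfl
    · have hw : F.map (F.dom.cls (a j) (hB j)) = w j :=
        (M.transportIso_map_cls g hg _ (hB j)).trans (hgw j)
      exact (congrArg F.inv.map hw).symm.trans (F.inv_map_map _)
  have hact := stable_stabilization _ ⟨(⟨F, hF, mods⟩, d), rfl⟩ (subset_stabilization _ hd)
  convert hact using 1
  simp only [act, DSet.mk.injEq]
  exact ⟨rfl, heq_of_eq (funext fun i => (F.map_inv_map (tup i)).symm)⟩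

end SemGpd
end

section
/- Let T be a set of L-sentences, let N ⊆ I_T be an open subset closed under composition and inverses, and let M ∈ M_T be the domain of some element of N. Then there exist a Horn formula φ with free variables among x₁,…,xₙ and an n-tuple a of pairwise distinct elements of S such that the identity isomorphism id_M lies in the set W := d⁻¹(⟨φ,a⟩) ∩ ⟨a₁↦a₁⟩ ∩ … ∩ ⟨aₙ↦aₙ⟩ ∩ c⁻¹(⟨φ,a⟩) ∩ I_T and W ⊆ N. -/
open FirstOrder Language Set Topology TopologicalSpace Cardinal

universe u v w

namespace SemGpd

variable (L : FirstOrder.Language.{u, v}) (S : Type w)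

variable {L S}

variable (L S)

variable {L S}

variable (L S)

variable {L S}

variable (L S)

variable {L S}

variable (L S)

variable {L S}

variable (L S)

variable {L S}

variable {L : FirstOrder.Language.{u, v}} {S : Type w}

/-- The set `W = d⁻¹⟨φ,a⟩ ∩ ⟨a₁↦a₁⟩ ∩ … ∩ ⟨aₙ↦aₙ⟩ ∩ c⁻¹⟨φ,a⟩ ∩ I_T`. -/
def WSet (T : Set L.Sentence) {n : ℕ} (φ : L.Formula (Fin n)) (a : Fin n → S) :
    Set (IsoT L S T) :=
  {F | F.1.dom ∈ fSet L S φ a ∧ (∀ i, F.1 ∈ mapSet (a i) (a i)) ∧ F.1.cod ∈ fSet L S φ a}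

theorem IsHorn.relabel {α β : Type*} {g : α → β} {n : ℕ} {φ : L.BoundedFormula α n}
    (h : IsHorn φ) :
    IsHorn (BoundedFormula.relabel (n := 0) (Sum.inl ∘ g : α → β ⊕ Fin 0) φ) := by
  induction h with
  | top => exact IsHorn.top
  | equal t₁ t₂ => exact IsHorn.equal _ _
  | rel R ts => exact IsHorn.rel _ _
  | inf _ _ h₁ h₂ => exact IsHorn.inf h₁ h₂

theorem IsHorn.formulaRelabel {α β : Type*} {g : α → β} {φ : L.Formula α} (h : IsHorn φ) :
    IsHorn (φ.relabel g) :=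
  IsHorn.relabel (g := g) h

theorem IsHorn.of_isAtomic {α : Type*} {n : ℕ} {φ : L.BoundedFormula α n}
    (h : BoundedFormula.IsAtomic φ) : IsHorn φ := by
  cases h with
  | equal t₁ t₂ => exact IsHorn.equal _ _
  | rel R ts => exact IsHorn.rel _ _

theorem mem_fSet_relabel {n m : ℕ} (φ : L.Formula (Fin n)) (g : Fin n → Fin m) (b : Fin m → S)
    (M : IndexedStructure L S) :
    M ∈ fSet L S (φ.relabel g) b ↔ (∀ i, b i ∈ M.A) ∧ M ∈ fSet L S φ (b ∘ g) := by
  let _ := M.str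
  constructor
  · rintro ⟨h, hs⟩
    exact ⟨h, fun i => h (g i),
      (Formula.realize_relabel (v := fun i => M.cls (b i) (h i))).mp hs⟩
  · rintro ⟨h, _, hs⟩
    exact ⟨h, (Formula.realize_relabel (v := fun i => M.cls (b i) (h i))).mpr hs⟩

theorem mem_fSet_inf {n : ℕ} (φ ψ : L.Formula (Fin n)) (a : Fin n → S)
    (M : IndexedStructure L S) :
    M ∈ fSet L S (φ ⊓ ψ) a ↔ M ∈ fSet L S φ a ∧ M ∈ fSet L S ψ a := by
  let _ := M.str
  constructor
  · rintro ⟨h, hs⟩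
    have hs' := Formula.realize_inf.mp hs
    exact ⟨⟨h, hs'.1⟩, ⟨h, hs'.2⟩⟩
  · rintro ⟨⟨h, hs⟩, ⟨_, hs'⟩⟩
    exact ⟨h, Formula.realize_inf.mpr ⟨hs, hs'⟩⟩

theorem mem_fSet_top {n : ℕ} (a : Fin n → S) (M : IndexedStructure L S) :
    M ∈ fSet L S (⊤ : L.Formula (Fin n)) a ↔ ∀ i, a i ∈ M.A := by
  let _ := M.str
  exact ⟨fun h => h.1, fun h => ⟨h, Formula.realize_top.mpr trivial⟩⟩

theorem mem_fSet_equal {n : ℕ} (i j : Fin n) (a : Fin n → S) (M : IndexedStructure L S) :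
    M ∈ fSet L S (Term.equal (Term.var i : L.Term (Fin n)) (Term.var j)) a ↔
      ∃ h : ∀ k, a k ∈ M.A, M.cls (a i) (h i) = M.cls (a j) (h j) := by
  let _ := M.str
  exact exists_congr fun h => Formula.realize_equal

/-- The set `d⁻¹⟨φ,a⟩ ∩ ⟨a₁↦a₁⟩ ∩ … ∩ ⟨aₙ↦aₙ⟩ ∩ c⁻¹⟨φ,a⟩` of isomorphisms. -/
def hornSet {n : ℕ} (φ : L.Formula (Fin n)) (a : Fin n → S) : Set (IndexedIso L S) :=
  {F | F.dom ∈ fSet L S φ a ∧ (∀ i, F ∈ mapSet (a i) (a i)) ∧ F.cod ∈ fSet L S φ a}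

theorem hornSet_relabel_subset {n m : ℕ} (φ : L.Formula (Fin n)) (g : Fin n → Fin m)
    (b : Fin m → S) : hornSet (φ.relabel g) b ⊆ hornSet φ (b ∘ g) := by
  rintro F ⟨h₁, h₂, h₃⟩
  exact ⟨((mem_fSet_relabel φ g b _).mp h₁).2, fun i => h₂ (g i),
    ((mem_fSet_relabel φ g b _).mp h₃).2⟩

theorem hornSet_inf_subset {n : ℕ} (φ ψ : L.Formula (Fin n)) (a : Fin n → S) :
    hornSet (φ ⊓ ψ) a ⊆ hornSet φ a ∩ hornSet ψ a := by
  rintro F ⟨h₁, h₂, h₃⟩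
  rw [mem_fSet_inf] at h₁ h₃
  exact ⟨⟨h₁.1, h₂, h₃.1⟩, ⟨h₁.2, h₂, h₃.2⟩⟩

theorem idIso_mem_mapSet (M : IndexedStructure L S) {a : S} (ha : a ∈ M.A) :
    idIso M ∈ mapSet (L := L) a a :=
  ⟨ha, ha, rfl⟩

/-- The filter on isomorphisms generated by the sets `hornSet φ a` with `M ∈ ⟨φ,a⟩`. -/
def hornFilter (M : IndexedStructure L S) : Filter (IndexedIso L S) where
  sets := {U | ∃ (n : ℕ) (φ : L.Formula (Fin n)) (a : Fin n → S),
    IsHorn φ ∧ M ∈ fSet L S φ a ∧ hornSet φ a ⊆ U}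
  univ_sets := ⟨0, ⊤, Fin.elim0, IsHorn.top, (mem_fSet_top _ M).mpr fun i => i.elim0,
    subset_univ _⟩
  sets_of_superset := by
    rintro U V ⟨n, φ, a, hφ, hM, hU⟩ hUV
    exact ⟨n, φ, a, hφ, hM, hU.trans hUV⟩
  inter_sets := by
    rintro U V ⟨n, φ, a, hφ, hM, hU⟩ ⟨m, ψ, b, hψ, hM', hV⟩
    have ha : Fin.append a b ∘ Fin.castAdd m = a := funext (Fin.append_left a b)
    have hb : Fin.append a b ∘ Fin.natAdd n = b := funext (Fin.append_right a b)
    have hab : ∀ i, Fin.append a b i ∈ M.A := by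
      refine Fin.addCases (fun i => ?_) fun i => ?_
      · simpa using hM.1 i
      · simpa using hM'.1 i
    refine ⟨n + m, φ.relabel (Fin.castAdd m) ⊓ ψ.relabel (Fin.natAdd n), Fin.append a b,
      hφ.formulaRelabel.inf hψ.formulaRelabel, ?_, ?_⟩
    · rw [mem_fSet_inf, mem_fSet_relabel, mem_fSet_relabel, ha, hb]
      exact ⟨⟨hab, hM⟩, ⟨hab, hM'⟩⟩
    · refine (hornSet_inf_subset _ _ _).trans (inter_subset_inter ?_ ?_)
      · refine (hornSet_relabel_subset _ _ _).trans ?_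
        rwa [ha]
      · refine (hornSet_relabel_subset _ _ _).trans ?_
        rwa [hb]

theorem hornSet_mem_hornFilter {M : IndexedStructure L S} {n : ℕ} {φ : L.Formula (Fin n)}
    {a : Fin n → S} (hφ : IsHorn φ) (hM : M ∈ fSet L S φ a) : hornSet φ a ∈ hornFilter M :=
  ⟨n, φ, a, hφ, hM, Subset.rfl⟩

/-- A map of isomorphisms sending each `hornSet φ a` into `⟨φ,a⟩` converges to `M` along the
filter `hornFilter M`. -/
theorem tendsto_hornFilter (M : IndexedStructure L S)
    (e : IndexedIso L S → IndexedStructure L S)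
    (he : ∀ (n : ℕ) (φ : L.Formula (Fin n)) (a : Fin n → S) (F : IndexedIso L S),
      F ∈ hornSet φ a → e F ∈ fSet L S φ a) :
    Filter.Tendsto e (hornFilter M) (@nhds _ (logicalTopology L S) M) := by
  refine tendsto_nhds_generateFrom_iff.mpr ?_
  rintro U (⟨a, rfl⟩ | ⟨n, φ, hφ, a, rfl⟩) hM
  · refine Filter.mem_of_superset
      (hornSet_mem_hornFilter (φ := ⊤) (a := fun _ : Fin 1 => a) IsHorn.top
        ((mem_fSet_top _ M).mpr fun _ => hM)) fun F hF => ?_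
    exact (he _ _ _ F hF).1 0
  · exact Filter.mem_of_superset (hornSet_mem_hornFilter (IsHorn.of_isAtomic hφ) hM)
      fun F hF => he _ _ _ F hF

theorem mapSet_mem_hornFilter {M : IndexedStructure L S} {a b : S}
    (h : idIso M ∈ mapSet a b) : mapSet a b ∈ hornFilter M := by
  obtain ⟨ha, hb, hab⟩ := h
  refine Filter.mem_of_superset
    (hornSet_mem_hornFilter (a := ![a, b])
      (φ := Term.equal (Term.var 0 : L.Term (Fin 2)) (Term.var 1)) (IsHorn.equal _ _)
      ((mem_fSet_equal _ _ _ _).mpr ⟨?_, hab⟩)) ?_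
  · rw [Fin.forall_fin_two]
    exact ⟨ha, hb⟩
  · rintro F ⟨_, h, hc⟩
    obtain ⟨ha', ha'', h₀⟩ := h 0
    obtain ⟨hc', hc⟩ := (mem_fSet_equal _ _ _ _).mp hc
    exact ⟨ha', hc' 1, h₀.trans hc⟩

theorem le_nhds_inf {X : Type*} {t₁ t₂ : TopologicalSpace X} {f : Filter X} {x : X}
    (h₁ : f ≤ @nhds X t₁ x) (h₂ : f ≤ @nhds X t₂ x) : f ≤ @nhds X (t₁ ⊓ t₂) x :=
  (le_inf h₁ h₂).trans_eq nhds_inf.symm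

theorem hornFilter_le_nhds (M : IndexedStructure L S) : hornFilter M ≤ 𝓝 (idIso M) := by
  have key := le_nhds_inf (f := hornFilter M) (x := idIso M)
    (t₁ := (logicalTopology L S).induced IndexedIso.dom ⊓
      (logicalTopology L S).induced IndexedIso.cod)
    (t₂ := generateFrom {V | ∃ a b : S, V = mapSet a b})
  refine key (le_nhds_inf (t₁ := (logicalTopology L S).induced IndexedIso.dom)
    (t₂ := (logicalTopology L S).induced IndexedIso.cod) ?_ ?_) ?_
  · rw [@nhds_induced _ _ (logicalTopology L S)]
    exact Filter.tendsto_iff_comap.mp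
      (tendsto_hornFilter M IndexedIso.dom fun _ _ _ _ hF => hF.1)
  · rw [@nhds_induced _ _ (logicalTopology L S)]
    exact Filter.tendsto_iff_comap.mp
      (tendsto_hornFilter M IndexedIso.cod fun _ _ _ _ hF => hF.2.2)
  · rw [nhds_generateFrom]
    refine le_iInf₂ fun V hV => Filter.le_principal_iff.mpr ?_
    obtain ⟨hV, a, b, rfl⟩ := hV
    exact mapSet_mem_hornFilter hV

/-- A tuple factors through an injective tuple with the same range. -/
theorem exists_injective_comp_eq {n : ℕ} (a : Fin n → S) :
    ∃ (m : ℕ) (g : Fin n → Fin m) (b : Fin m → S),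
      Function.Injective b ∧ Function.Surjective g ∧ b ∘ g = a := by
  obtain ⟨m, ⟨e⟩⟩ := Finite.exists_equiv_fin (range a)
  refine ⟨m, e ∘ rangeFactorization a, Subtype.val ∘ e.symm,
    Subtype.val_injective.comp e.symm.injective,
    e.surjective.comp rangeFactorization_surjective, ?_⟩
  funext i
  simp

theorem IsoT.comp_inv_self {T : Set L.Sentence} (F : IsoT L S T) :
    F.comp F.inv rfl = idIsoT F.d := by
  let _ := F.1.dom.str
  let _ := F.1.cod.str
  refine Subtype.ext ?_
  exact congrArg (IndexedIso.mk F.1.dom F.1.dom) F.1.iso.symm_comp_self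

theorem stmt17 (T : Set L.Sentence) (N : Set (IsoT L S T)) (hopen : IsOpen N)
    (hinv : ∀ F ∈ N, IsoT.inv F ∈ N)
    (hcomp : ∀ F G, F ∈ N → G ∈ N → ∀ h : F.1.cod = G.1.dom, F.comp G h ∈ N)
    (M : ModelsT L S T) (hM : ∃ F ∈ N, F.1.dom = M.1) :
    ∃ (n : ℕ) (φ : L.Formula (Fin n)), IsHorn φ ∧
      ∃ a : Fin n → S, Function.Injective a ∧
        idIsoT M ∈ WSet T φ a ∧ WSet T φ a ⊆ N := by
  have hid : idIsoT M ∈ N := by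
    obtain ⟨F, hF, hFM⟩ := hM
    obtain rfl : F.d = M := Subtype.ext hFM
    rw [← IsoT.comp_inv_self]
    exact hcomp F F.inv hF (hinv F hF) rfl
  obtain ⟨U, hU, rfl⟩ := isOpen_induced_iff.mp hopen
  obtain ⟨n, φ, a, hφ, hMφ, hsub⟩ := hornFilter_le_nhds M.1 (hU.mem_nhds hid)
  obtain ⟨m, g, b, hb, hg, rfl⟩ := exists_injective_comp_eq a
  have hbM : ∀ i, b i ∈ M.1.A := hg.forall.mpr hMφ.1
  have hMb : M.1 ∈ fSet L S (φ.relabel g) b := (mem_fSet_relabel φ g b _).mpr ⟨hbM, hMφ⟩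
  exact ⟨m, φ.relabel g, hφ.formulaRelabel, b, hb,
    ⟨hMb, fun i => idIso_mem_mapSet M.1 (hbM i), hMb⟩,
    fun F hF => hsub (hornSet_relabel_subset φ g b hF)⟩

end SemGpd
end
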